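/- Let n ≥ 2 and α ∈ (0,1). There is a constant C = C(n,α) > 0 with the following property: if g ∈ L²_{loc}(ℝⁿ) satisfies ‖g‖_{L_{2,n−2}} < ∞, and the Riesz potential f(x) = ∫_{ℝⁿ} g(y) |x−y|^{1−n} dy converges absolutely for a.e. x ∈ ℝⁿ, then ‖f‖_{Q_α} ≤ C ‖g‖_{L_{2,n−2}}; that is, (−Δ)^{−1/2}L_{2,n−2} ⊆ Q_α. -/

import Mathlib

open MeasureTheory Metric Real
open scoped ENNReal NNReal

noncomputable section

/-- The `Q_α` seminorm of `f : ℝⁿ → ℂ`. -/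
def QNorm (n : ℕ) (α : ℝ) (f : EuclideanSpace ℝ (Fin n) → ℂ) : ℝ≥0∞ :=
  ⨆ (r : ℝ) (_ : 0 < r) (x : EuclideanSpace ℝ (Fin n)),
    (ENNReal.ofReal (r ^ (2 * α - (n : ℝ))) *
      ∫⁻ y in Metric.ball x r, ∫⁻ z in Metric.ball x r,
        (‖f y - f z‖₊ : ℝ≥0∞) ^ 2 /
          ENNReal.ofReal (‖y - z‖ ^ ((n : ℝ) + 2 * α))) ^ (1 / 2 : ℝ)

/-- The square Morrey norm `‖g‖_{L_{2,n−2}}`. -/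
def MorreyNorm (n : ℕ) (g : EuclideanSpace ℝ (Fin n) → ℂ) : ℝ≥0∞ :=
  ⨆ (r : ℝ) (_ : 0 < r) (x : EuclideanSpace ℝ (Fin n)),
    (ENNReal.ofReal (r ^ ((2 : ℝ) - (n : ℝ))) *
      ∫⁻ y in Metric.ball x r, (‖g y‖₊ : ℝ≥0∞) ^ 2) ^ (1 / 2 : ℝ)

/-- The kernel `‖u‖ ^ (-s)` with values in `ℝ≥0∞`. -/
def powKernel {E : Type*} [Norm E] (s : ℝ) (u : E) : ℝ≥0∞ :=
  ENNReal.ofReal (‖u‖ ^ (-s))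

section PowKernel

variable {E : Type*} [NormedAddCommGroup E]

lemma powKernel_zero {s : ℝ} (hs : 0 < s) : powKernel s (0 : E) = 0 := by
  simp [powKernel, Real.zero_rpow (neg_ne_zero.mpr hs.ne')]

lemma powKernel_add {a b : ℝ} (ha : 0 < a) (hb : 0 < b) (u : E) :
    powKernel (a + b) u = powKernel a u * powKernel b u := by
  rcases eq_or_ne u 0 with rfl | hu
  · rw [powKernel_zero ha, powKernel_zero (add_pos ha hb), zero_mul]
  · unfold powKernel
    rw [← ENNReal.ofReal_mul (by positivity), ← Real.rpow_add (norm_pos_iff.mpr hu), neg_add]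

lemma powKernel_half_sq {s : ℝ} (hs : 0 < s) (u : E) :
    powKernel (s / 2) u ^ 2 = powKernel s u := by
  rw [sq, ← powKernel_add (half_pos hs) (half_pos hs), add_halves]

lemma powKernel_sub_comm (s : ℝ) (x y : E) : powKernel s (x - y) = powKernel s (y - x) := by
  rw [powKernel, powKernel, norm_sub_rev]

variable [MeasurableSpace E] [BorelSpace E]

@[fun_prop]
lemma measurable_powKernel (s : ℝ) : Measurable (powKernel s : E → ℝ≥0∞) := by
  unfold powKernel
  fun_prop

/-- Integral of a power kernel over a region covered by geometric shells, against a measure with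
power growth. -/
lemma lintegral_powKernel_le_of_shells {d s q : ℝ} (hs : 0 < s) (hq : 0 < q)
    {μ : Measure E} {x : E} {A : ℝ≥0∞}
    (hμ : ∀ t > 0, μ (ball x t) ≤ ENNReal.ofReal (t ^ d) * A)
    {r : ℝ} (hr : 0 < r) {S : Set E} (hS : MeasurableSet S)
    (hcov : ∀ w ∈ S, w ≠ x → ∃ k : ℕ, r * q ^ k ≤ ‖x - w‖ ∧ ‖x - w‖ < 4 * (r * q ^ k)) :
    ∫⁻ w in S, powKernel s (x - w) ∂μ ≤
      ENNReal.ofReal (4 ^ d) * (1 - ENNReal.ofReal (q ^ (d - s)))⁻¹ *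
        ENNReal.ofReal (r ^ (d - s)) * A := by
  have ha : ∀ k : ℕ, 0 < r * q ^ k := fun k => by positivity
  calc ∫⁻ w in S, powKernel s (x - w) ∂μ
      ≤ ∫⁻ w in S, ∑' k : ℕ, (ball x (4 * (r * q ^ k))).indicator
          (fun _ => ENNReal.ofReal ((r * q ^ k) ^ (-s))) w ∂μ := by
        refine setLIntegral_mono' hS fun w hw => ?_
        rcases eq_or_ne w x with rfl | hwx
        · rw [sub_self, powKernel_zero hs]
          exact zero_le
        · obtain ⟨k, hk1, hk2⟩ := hcov w hw hwx
          refine le_trans ?_ (ENNReal.le_tsum k)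
          rw [Set.indicator_of_mem (by rwa [mem_ball, dist_comm, dist_eq_norm])]
          exact ENNReal.ofReal_le_ofReal
            (Real.rpow_le_rpow_of_nonpos (ha k) hk1 (neg_nonpos.mpr hs.le))
    _ ≤ ∫⁻ w, ∑' k : ℕ, (ball x (4 * (r * q ^ k))).indicator
          (fun _ => ENNReal.ofReal ((r * q ^ k) ^ (-s))) w ∂μ :=
        setLIntegral_le_lintegral _ _
    _ = ∑' k : ℕ, ENNReal.ofReal ((r * q ^ k) ^ (-s)) * μ (ball x (4 * (r * q ^ k))) := by
        rw [lintegral_tsum fun k => (measurable_const.indicator measurableSet_ball).aemeasurable]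
        simp_rw [lintegral_indicator_const measurableSet_ball]
    _ ≤ ∑' k : ℕ, ENNReal.ofReal (4 ^ d) * ENNReal.ofReal (r ^ (d - s)) * A *
          ENNReal.ofReal (q ^ (d - s)) ^ k := by
        refine ENNReal.tsum_le_tsum fun k => ?_
        refine (mul_le_mul_right (hμ _ (by have := ha k; positivity)) _).trans (le_of_eq ?_)
        rw [← ENNReal.ofReal_pow (by positivity), ← mul_assoc,
          ← ENNReal.ofReal_mul (by have := ha k; positivity)]
        rw [mul_right_comm, ← ENNReal.ofReal_mul (by positivity),
          ← ENNReal.ofReal_mul (by positivity)]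
        congr 2
        rw [Real.mul_rpow (by norm_num) (ha k).le, mul_left_comm, ← Real.rpow_add (ha k),
          Real.mul_rpow hr.le (by positivity), ← Real.rpow_natCast, ← Real.rpow_natCast,
          ← Real.rpow_mul hq.le, ← Real.rpow_mul hq.le]
        ring_nf
    _ = _ := by
        rw [ENNReal.tsum_mul_left, ENNReal.tsum_geometric]
        ring

lemma lintegral_powKernel_compl_ball_le {d s : ℝ} (hs : 0 < s) (hds : d < s) :
    ∃ C : ℝ≥0, ∀ (μ : Measure E) (x : E) (A : ℝ≥0∞),
      (∀ t > 0, μ (ball x t) ≤ ENNReal.ofReal (t ^ d) * A) → ∀ r > 0,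
        ∫⁻ w in (ball x r)ᶜ, powKernel s (x - w) ∂μ ≤ C * ENNReal.ofReal (r ^ (d - s)) * A := by
  have hlt : ENNReal.ofReal ((2 : ℝ) ^ (d - s)) < 1 := by
    rw [ENNReal.ofReal_lt_one]
    exact Real.rpow_lt_one_of_one_lt_of_neg (by norm_num) (by linarith)
  refine ⟨(ENNReal.ofReal (4 ^ d) * (1 - ENNReal.ofReal (2 ^ (d - s)))⁻¹).toNNReal,
    fun μ x A hμ r hr => ?_⟩
  rw [ENNReal.coe_toNNReal (ENNReal.mul_ne_top ENNReal.ofReal_ne_top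
    (ENNReal.inv_ne_top.mpr (tsub_pos_of_lt hlt).ne'))]
  refine lintegral_powKernel_le_of_shells hs two_pos hμ hr measurableSet_ball.compl
    fun w hw _ => ?_
  have hw' : r ≤ ‖x - w‖ := by
    simpa [mem_ball, dist_comm, dist_eq_norm, norm_sub_rev] using hw
  obtain ⟨k, hk1, hk2⟩ := exists_nat_pow_near ((one_le_div hr).mpr hw') (one_lt_two (α := ℝ))
  rw [le_div_iff₀ hr] at hk1
  rw [div_lt_iff₀ hr, pow_succ] at hk2
  have : 0 < (2 : ℝ) ^ k * r := by positivity
  exact ⟨k, by linarith, by linarith⟩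

lemma lintegral_powKernel_ball_le {d s : ℝ} (hs : 0 < s) (hds : s < d) :
    ∃ C : ℝ≥0, ∀ (μ : Measure E) (x : E) (A : ℝ≥0∞),
      (∀ t > 0, μ (ball x t) ≤ ENNReal.ofReal (t ^ d) * A) → ∀ r > 0,
        ∫⁻ w in ball x r, powKernel s (x - w) ∂μ ≤ C * ENNReal.ofReal (r ^ (d - s)) * A := by
  have hlt : ENNReal.ofReal ((1 / 2 : ℝ) ^ (d - s)) < 1 := by
    rw [ENNReal.ofReal_lt_one]
    exact Real.rpow_lt_one (by norm_num) (by norm_num) (by linarith)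
  refine ⟨(ENNReal.ofReal (4 ^ d) * (1 - ENNReal.ofReal ((1 / 2) ^ (d - s)))⁻¹ *
    ENNReal.ofReal ((1 / 2) ^ (d - s))).toNNReal, fun μ x A hμ r hr => ?_⟩
  rw [ENNReal.coe_toNNReal (ENNReal.mul_ne_top (ENNReal.mul_ne_top ENNReal.ofReal_ne_top
    (ENNReal.inv_ne_top.mpr (tsub_pos_of_lt hlt).ne')) ENNReal.ofReal_ne_top)]
  have key := lintegral_powKernel_le_of_shells (d := d) (s := s) (q := 1 / 2) (S := ball x r)
    (r := 1 / 2 * r) hs (by norm_num) hμ (by positivity) measurableSet_ball ?_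
  · rwa [Real.mul_rpow (by norm_num) hr.le, ENNReal.ofReal_mul (by positivity), ← mul_assoc] at key
  intro w hw hwx
  have hw' : ‖x - w‖ < r := by rwa [mem_ball, dist_comm, dist_eq_norm] at hw
  have hpos : 0 < ‖x - w‖ := norm_pos_iff.mpr (sub_ne_zero.mpr hwx.symm)
  obtain ⟨k, hk1, hk2⟩ := exists_nat_pow_near_of_lt_one (div_pos hpos hr)
    ((div_le_one hr).mpr hw'.le) (by norm_num : (0 : ℝ) < 1 / 2) (by norm_num)
  rw [div_le_iff₀ hr] at hk2
  rw [lt_div_iff₀ hr, pow_succ] at hk1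
  have : 0 < (1 / 2 : ℝ) ^ k * r := by positivity
  exact ⟨k, by linarith, by linarith⟩

end PowKernel

lemma sq_lintegral_mul_le {X : Type*} [MeasurableSpace X] {μ : Measure X} {u v : X → ℝ≥0∞}
    (hu : AEMeasurable u μ) (hv : AEMeasurable v μ) :
    (∫⁻ x, u x * v x ∂μ) ^ 2 ≤ (∫⁻ x, u x ^ 2 ∂μ) * ∫⁻ x, v x ^ 2 ∂μ := by
  have h := ENNReal.lintegral_mul_le_Lp_mul_Lq μ Real.HolderConjugate.two_two hu hv
  have hsq : ∀ c : ℝ≥0∞, (c ^ (1 / 2 : ℝ)) ^ 2 = c := fun c => by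
    rw [← ENNReal.rpow_natCast, ← ENNReal.rpow_mul]; norm_num
  calc _ ≤ _ := pow_le_pow_left' h 2
    _ = _ := by rw [mul_pow, hsq, hsq]; simp

/-- Hölder-type estimate for a difference of negative powers. -/
lemma abs_rpow_neg_sub_rpow_neg_le {p : ℕ} (hp : 1 ≤ p) {β : ℝ} (hβ0 : 0 < β) (hβ1 : β < 1)
    {s t : ℝ} (hs : 0 < s) (ht : 0 < t) :
    |s ^ (-(p : ℝ)) - t ^ (-(p : ℝ))| ≤
      p * |s - t| ^ β * (s ^ (-(p + β)) + t ^ (-(p + β))) := by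
  wlog hst : s ≤ t generalizing s t
  · rw [abs_sub_comm, abs_sub_comm s, add_comm (s ^ _)]
    exact this ht hs (le_of_not_ge hst)
  have hp' : (1 : ℝ) ≤ p := by exact_mod_cast hp
  have hmono : t ^ (-(p : ℝ)) ≤ s ^ (-(p : ℝ)) :=
    Real.rpow_le_rpow_of_nonpos hs hst (by linarith)
  rw [abs_of_nonneg (by linarith), abs_sub_comm, abs_of_nonneg (by linarith)]
  have hu0 : 0 ≤ s / t := by positivity
  have hu1 : s / t ≤ 1 := (div_le_one ht).mpr hst
  have hbern : 1 - (s / t) ^ p ≤ p * (1 - s / t) := by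
    have := one_add_mul_le_pow (a := s / t - 1) (by linarith) p
    rw [add_sub_cancel] at this
    linarith
  have hle : 1 - s / t ≤ (1 - s / t) ^ β := by
    simpa using Real.rpow_le_rpow_of_exponent_ge' (by linarith : 0 ≤ 1 - s / t)
      (by linarith) hβ0.le hβ1.le
  have hquot : (1 - s / t) ^ β ≤ (t - s) ^ β * s ^ (-β) := by
    rw [Real.rpow_neg hs.le, ← div_eq_mul_inv, ← Real.div_rpow (by linarith) hs.le]
    refine Real.rpow_le_rpow (by linarith) ?_ hβ0.le
    rw [one_sub_div ht.ne']
    exact div_le_div_of_nonneg_left (by linarith) hs hst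
  have heq : s ^ (-(p : ℝ)) - t ^ (-(p : ℝ)) = s ^ (-(p : ℝ)) * (1 - (s / t) ^ p) := by
    rw [Real.rpow_neg hs.le, Real.rpow_neg ht.le, Real.rpow_natCast, Real.rpow_natCast]
    rw [div_pow]
    field_simp
  have hts : 0 ≤ t ^ (-(p + β)) := by positivity
  calc _ = s ^ (-(p : ℝ)) * (1 - (s / t) ^ p) := heq
    _ ≤ s ^ (-(p : ℝ)) * (p * ((t - s) ^ β * s ^ (-β))) := by
        refine mul_le_mul_of_nonneg_left (hbern.trans ?_) (by positivity)
        exact mul_le_mul_of_nonneg_left (hle.trans hquot) (by positivity)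
    _ = p * (t - s) ^ β * s ^ (-(p + β)) := by
        rw [neg_add, Real.rpow_add hs]
        ring
    _ ≤ _ := by
        refine mul_le_mul_of_nonneg_left (by linarith) ?_
        have : 0 ≤ (t - s) ^ β := Real.rpow_nonneg (by linarith) _
        positivity

lemma ENNReal.add_sq_le_four_mul (a b : ℝ≥0∞) : (a + b) ^ 2 ≤ 4 * (a ^ 2 + b ^ 2) := by
  have h : a + b ≤ 2 * max a b := by
    rw [two_mul]
    exact add_le_add (le_max_left _ _) (le_max_right _ _)
  calc (a + b) ^ 2 ≤ (2 * max a b) ^ 2 := pow_le_pow_left' h 2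
    _ = 4 * (max a b) ^ 2 := by rw [mul_pow]; norm_num
    _ ≤ 4 * (a ^ 2 + b ^ 2) := by
      refine mul_le_mul_right ?_ _
      rcases max_cases a b with ⟨h, -⟩ | ⟨h, -⟩ <;> rw [h]
      · exact le_self_add
      · exact le_add_self

/-- The growth condition `∫_{B(x,t)} h² ≤ t^{n-2} A` on all balls. -/
def MorreyGrowth (n : ℕ) (h : EuclideanSpace ℝ (Fin n) → ℝ≥0∞) (A : ℝ≥0∞) : Prop :=
  ∀ (x : EuclideanSpace ℝ (Fin n)), ∀ t > 0,
    ∫⁻ y in ball x t, h y ^ 2 ≤ ENNReal.ofReal (t ^ ((n : ℝ) - 2)) * A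

/-- The potential of `h` with kernel `‖u‖ ^ (-s)`. -/
def powPotential {n : ℕ} (s : ℝ) (h : EuclideanSpace ℝ (Fin n) → ℝ≥0∞)
    (y : EuclideanSpace ℝ (Fin n)) : ℝ≥0∞ :=
  ∫⁻ w, powKernel s (y - w) * h w

section Potential

variable {n : ℕ}

lemma volume_ball_le_rpow (x : EuclideanSpace ℝ (Fin n)) (t : ℝ) (ht : 0 < t) :
    volume (ball x t) ≤
      ENNReal.ofReal (t ^ (n : ℝ)) * volume (ball (0 : EuclideanSpace ℝ (Fin n)) 1) := by
  rw [Measure.addHaar_ball_of_pos volume x ht, finrank_euclideanSpace_fin, Real.rpow_natCast]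

lemma volume_unit_ball_ne_top : volume (ball (0 : EuclideanSpace ℝ (Fin n)) 1) ≠ ⊤ :=
  measure_ball_lt_top.ne

lemma exists_volume_powKernel_ball_le {s : ℝ} (hs : 0 < s) (hsn : s < n) :
    ∃ C : ℝ≥0, ∀ (x : EuclideanSpace ℝ (Fin n)), ∀ r > 0,
      ∫⁻ w in ball x r, powKernel s (x - w) ≤ C * ENNReal.ofReal (r ^ (n - s)) := by
  obtain ⟨C, hC⟩ := lintegral_powKernel_ball_le (E := EuclideanSpace ℝ (Fin n)) hs hsn
  refine ⟨C * (volume (ball (0 : EuclideanSpace ℝ (Fin n)) 1)).toNNReal, fun x r hr => ?_⟩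
  refine (hC volume x _ (volume_ball_le_rpow x) r hr).trans (le_of_eq ?_)
  rw [ENNReal.coe_mul, ENNReal.coe_toNNReal volume_unit_ball_ne_top]
  ring

lemma exists_volume_powKernel_compl_ball_le {s : ℝ} (hs : 0 < s) (hsn : (n : ℝ) < s) :
    ∃ C : ℝ≥0, ∀ (x : EuclideanSpace ℝ (Fin n)), ∀ r > 0,
      ∫⁻ w in (ball x r)ᶜ, powKernel s (x - w) ≤ C * ENNReal.ofReal (r ^ (n - s)) := by
  obtain ⟨C, hC⟩ := lintegral_powKernel_compl_ball_le (E := EuclideanSpace ℝ (Fin n)) hs hsn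
  refine ⟨C * (volume (ball (0 : EuclideanSpace ℝ (Fin n)) 1)).toNNReal, fun x r hr => ?_⟩
  refine (hC volume x _ (volume_ball_le_rpow x) r hr).trans (le_of_eq ?_)
  rw [ENNReal.coe_mul, ENNReal.coe_toNNReal volume_unit_ball_ne_top]
  ring

lemma exists_sq_far_potential_le (hn : 2 ≤ n) {β : ℝ} (hβ : 0 < β) :
    ∃ C : ℝ≥0, ∀ (h : EuclideanSpace ℝ (Fin n) → ℝ≥0∞), Measurable h → ∀ A : ℝ≥0∞,
      MorreyGrowth n h A → ∀ (y : EuclideanSpace ℝ (Fin n)), ∀ r > 0,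
        (∫⁻ w in (ball y r)ᶜ, powKernel (n - 1 + β) (y - w) * h w) ^ 2 ≤
          C * ENNReal.ofReal (r ^ (-2 * β)) * A := by
  have hn' : (2 : ℝ) ≤ n := by exact_mod_cast hn
  obtain ⟨C₁, hC₁⟩ := exists_volume_powKernel_compl_ball_le (n := n) (s := n + β)
    (by linarith) (by linarith)
  obtain ⟨C₂, hC₂⟩ := lintegral_powKernel_compl_ball_le (E := EuclideanSpace ℝ (Fin n))
    (d := n - 2) (s := n - 2 + β) (by linarith) (by linarith)
  refine ⟨C₁ * C₂, fun h hh A hA y r hr => ?_⟩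
  have hsplit : ∀ w, powKernel (n - 1 + β) (y - w) * h w =
      powKernel ((n + β) / 2) (y - w) * (powKernel ((n - 2 + β) / 2) (y - w) * h w) := by
    intro w
    rw [← mul_assoc, ← powKernel_add (by linarith) (by linarith)]
    congr 2
    ring
  simp_rw [hsplit]
  refine (sq_lintegral_mul_le (by fun_prop) (by fun_prop)).trans ?_
  simp_rw [mul_pow, powKernel_half_sq (show (0 : ℝ) < n + β by linarith),
    powKernel_half_sq (show (0 : ℝ) < n - 2 + β by linarith)]
  have h2 := hC₂ (volume.withDensity fun w => h w ^ 2) y A (fun t ht => by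
    rw [withDensity_apply _ measurableSet_ball]
    exact hA y t ht) r hr
  rw [setLIntegral_withDensity_eq_setLIntegral_mul _ (by fun_prop) (by fun_prop)
    measurableSet_ball.compl] at h2
  simp only [Pi.mul_apply, mul_comm (h _ ^ 2)] at h2
  refine (mul_le_mul' (hC₁ y r hr) h2).trans (le_of_eq ?_)
  have : ENNReal.ofReal (r ^ (-2 * β)) = ENNReal.ofReal (r ^ ((n : ℝ) - (n + β))) *
      ENNReal.ofReal (r ^ ((n : ℝ) - 2 - (n - 2 + β))) := by
    rw [← ENNReal.ofReal_mul (by positivity), ← Real.rpow_add hr]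
    ring_nf
  rw [this, ENNReal.coe_mul]
  ring

lemma exists_lintegral_sq_near_potential_le (hn : 2 ≤ n) {β : ℝ} (hβ0 : 0 < β) (hβ1 : β < 1) :
    ∃ C : ℝ≥0, ∀ (h : EuclideanSpace ℝ (Fin n) → ℝ≥0∞), Measurable h → ∀ A : ℝ≥0∞,
      MorreyGrowth n h A → ∀ (x : EuclideanSpace ℝ (Fin n)), ∀ r > 0,
        ∫⁻ y in ball x r, (∫⁻ w in ball y r, powKernel (n - 1 + β) (y - w) * h w) ^ 2 ≤
          C * ENNReal.ofReal (r ^ (n - 2 * β)) * A := by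
  have hn' : (2 : ℝ) ≤ n := by exact_mod_cast hn
  set s : ℝ := n - 1 + β with hs_def
  have hs : 0 < s := by linarith
  obtain ⟨C, hC⟩ := exists_volume_powKernel_ball_le (n := n) hs (by linarith)
  refine ⟨C * C * (ENNReal.ofReal (2 ^ ((n : ℝ) - 2))).toNNReal, fun h hh A hA x r hr => ?_⟩
  rw [ENNReal.coe_mul, ENNReal.coe_toNNReal ENNReal.ofReal_ne_top, ENNReal.coe_mul]
  set V : ℝ≥0∞ := C * ENNReal.ofReal (r ^ (n - s)) with hV
  have hVr : V * V * (ENNReal.ofReal ((2 * r) ^ ((n : ℝ) - 2)) * A) =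
      C * C * ENNReal.ofReal (2 ^ ((n : ℝ) - 2)) * ENNReal.ofReal (r ^ (n - 2 * β)) * A := by
    have : ENNReal.ofReal (r ^ (n - 2 * β)) = ENNReal.ofReal (r ^ (n - s)) *
        ENNReal.ofReal (r ^ (n - s)) * ENNReal.ofReal (r ^ ((n : ℝ) - 2)) := by
      rw [← ENNReal.ofReal_mul (by positivity), ← ENNReal.ofReal_mul (by positivity),
        ← Real.rpow_add hr, ← Real.rpow_add hr]
      congr 2
      rw [hs_def]
      ring
    rw [this, Real.mul_rpow (by norm_num) hr.le, ENNReal.ofReal_mul (by positivity), hV]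
    ring
  rw [← hVr]
  have hpoint : ∀ y ∈ ball x r, (∫⁻ w in ball y r, powKernel s (y - w) * h w) ^ 2 ≤
      V * ∫⁻ w in ball x (2 * r), (ball w r).indicator (fun y => powKernel s (y - w)) y *
        h w ^ 2 := by
    intro y hy
    have hsplit : ∀ w, powKernel s (y - w) * h w =
        powKernel (s / 2) (y - w) * (powKernel (s / 2) (y - w) * h w) := by
      intro w
      rw [← mul_assoc, ← sq, powKernel_half_sq hs]
    simp_rw [hsplit]
    refine (sq_lintegral_mul_le (by fun_prop) (by fun_prop)).trans ?_
    simp_rw [mul_pow, powKernel_half_sq hs]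
    refine mul_le_mul' (hC y r hr) ?_
    calc ∫⁻ w in ball y r, powKernel s (y - w) * h w ^ 2
        ≤ ∫⁻ w in ball y r, (ball w r).indicator (fun y => powKernel s (y - w)) y *
            h w ^ 2 := by
          refine setLIntegral_mono' measurableSet_ball fun w hw => ?_
          rw [Set.indicator_of_mem (mem_ball_comm.mp hw)]
      _ ≤ _ := lintegral_mono_set (ball_subset_ball' (by
          rw [mem_ball] at hy
          linarith))
  have hmeas : Measurable fun p : EuclideanSpace ℝ (Fin n) × EuclideanSpace ℝ (Fin n) =>
      (ball p.2 r).indicator (fun y => powKernel s (y - p.2)) p.1 * h p.2 ^ 2 := by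
    have : (fun p : EuclideanSpace ℝ (Fin n) × EuclideanSpace ℝ (Fin n) =>
        (ball p.2 r).indicator (fun y => powKernel s (y - p.2)) p.1) =
        {p : EuclideanSpace ℝ (Fin n) × EuclideanSpace ℝ (Fin n) |
          dist p.1 p.2 < r}.indicator (fun p => powKernel s (p.1 - p.2)) := by
      ext p
      by_cases hp : dist p.1 p.2 < r <;> simp [hp]
    refine Measurable.mul ?_ (by fun_prop)
    rw [this]
    exact Measurable.indicator (by fun_prop)
      (measurableSet_lt (by fun_prop) measurable_const)
  calc _ ≤ ∫⁻ y in ball x r, V * ∫⁻ w in ball x (2 * r),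
        (ball w r).indicator (fun y => powKernel s (y - w)) y * h w ^ 2 :=
        setLIntegral_mono' measurableSet_ball hpoint
    _ = V * ∫⁻ w in ball x (2 * r), ∫⁻ y in ball x r,
        (ball w r).indicator (fun y => powKernel s (y - w)) y * h w ^ 2 := by
        rw [lintegral_const_mul _ (Measurable.lintegral_prod_right' hmeas)]
        rw [lintegral_lintegral_swap hmeas.aemeasurable]
    _ ≤ V * ∫⁻ w in ball x (2 * r), V * h w ^ 2 := by
        refine mul_le_mul_right (lintegral_mono fun w => ?_) _
        rw [lintegral_mul_const _
          (Measurable.indicator (by fun_prop) measurableSet_ball)]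
        refine mul_le_mul_left ((setLIntegral_le_lintegral _ _).trans ?_) _
        rw [lintegral_indicator measurableSet_ball]
        simp_rw [powKernel_sub_comm s _ w]
        exact hC w r hr
    _ ≤ _ := by
        rw [lintegral_const_mul _ (by fun_prop), ← mul_assoc]
        exact mul_le_mul_right (hA x (2 * r) (by positivity)) _

lemma measurable_powPotential (s : ℝ) {h : EuclideanSpace ℝ (Fin n) → ℝ≥0∞}
    (hh : Measurable h) : Measurable (powPotential s h) := by
  unfold powPotential
  exact Measurable.lintegral_prod_right' (f := fun p : EuclideanSpace ℝ (Fin n) ×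
    EuclideanSpace ℝ (Fin n) => powKernel s (p.1 - p.2) * h p.2) (by fun_prop)

/-- Local square estimate for the potential of a function with Morrey growth. -/
lemma exists_lintegral_sq_powPotential_le (hn : 2 ≤ n) {β : ℝ} (hβ0 : 0 < β) (hβ1 : β < 1) :
    ∃ C : ℝ≥0, ∀ (h : EuclideanSpace ℝ (Fin n) → ℝ≥0∞), Measurable h → ∀ A : ℝ≥0∞,
      MorreyGrowth n h A → ∀ (x : EuclideanSpace ℝ (Fin n)), ∀ r > 0,
        ∫⁻ y in ball x r, powPotential (n - 1 + β) h y ^ 2 ≤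
          C * ENNReal.ofReal (r ^ (n - 2 * β)) * A := by
  obtain ⟨C₁, hC₁⟩ := exists_lintegral_sq_near_potential_le hn hβ0 hβ1
  obtain ⟨C₂, hC₂⟩ := exists_sq_far_potential_le hn hβ0
  refine ⟨4 * (C₁ + C₂ * (volume (ball (0 : EuclideanSpace ℝ (Fin n)) 1)).toNNReal),
    fun h hh A hA x r hr => ?_⟩
  simp only [ENNReal.coe_mul, ENNReal.coe_add, ENNReal.coe_toNNReal volume_unit_ball_ne_top]
  calc _ ≤ ∫⁻ y in ball x r,
        4 * ((∫⁻ w in ball y r, powKernel (n - 1 + β) (y - w) * h w) ^ 2 +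
          C₂ * ENNReal.ofReal (r ^ (-2 * β)) * A) := by
        refine lintegral_mono fun y => ?_
        dsimp only
        rw [powPotential, ← lintegral_add_compl _ (measurableSet_ball (x := y) (ε := r))]
        refine (ENNReal.add_sq_le_four_mul _ _).trans ?_
        gcongr
        exact hC₂ h hh A hA y r hr
    _ = 4 * ((∫⁻ y in ball x r, (∫⁻ w in ball y r, powKernel (n - 1 + β) (y - w) * h w) ^ 2) +
          C₂ * ENNReal.ofReal (r ^ (-2 * β)) * A * volume (ball x r)) := by
        rw [lintegral_const_mul' _ _ (by norm_num), lintegral_add_right _ measurable_const,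
          setLIntegral_const]
    _ ≤ 4 * (C₁ * ENNReal.ofReal (r ^ (n - 2 * β)) * A +
          C₂ * ENNReal.ofReal (r ^ (-2 * β)) * A * (ENNReal.ofReal (r ^ (n : ℝ)) *
            volume (ball (0 : EuclideanSpace ℝ (Fin n)) 1))) := by
        gcongr
        · exact hC₁ h hh A hA x r hr
        · exact volume_ball_le_rpow x r hr
    _ = _ := by
        have : ENNReal.ofReal (r ^ (n - 2 * β)) =
            ENNReal.ofReal (r ^ (-2 * β)) * ENNReal.ofReal (r ^ (n : ℝ)) := by
          rw [← ENNReal.ofReal_mul (by positivity), ← Real.rpow_add hr]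
          ring_nf
        rw [this]
        push_cast
        ring

/-- A double integral of a power kernel against a sum of functions of one variable. -/
lemma lintegral_lintegral_powKernel_mul_add_le {s : ℝ} {G : EuclideanSpace ℝ (Fin n) → ℝ≥0∞}
    (hG : Measurable G) {B : Set (EuclideanSpace ℝ (Fin n))} {V : ℝ≥0∞}
    (hB : MeasurableSet B) (hV : ∀ y ∈ B, ∫⁻ z in B, powKernel s (y - z) ≤ V) :
    ∫⁻ y in B, ∫⁻ z in B, powKernel s (y - z) * (G y + G z) ≤ 2 * V * ∫⁻ y in B, G y := by
  have hle : ∫⁻ y in B, ∫⁻ z in B, powKernel s (y - z) * G y ≤ V * ∫⁻ y in B, G y := by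
    rw [← lintegral_const_mul _ hG]
    refine setLIntegral_mono' hB fun y hy => ?_
    rw [lintegral_mul_const _ (by fun_prop)]
    exact mul_le_mul_left (hV y hy) _
  have hswap : ∫⁻ y in B, ∫⁻ z in B, powKernel s (y - z) * G z =
      ∫⁻ y in B, ∫⁻ z in B, powKernel s (y - z) * G y := by
    rw [lintegral_lintegral_swap (Measurable.aemeasurable (by fun_prop))]
    simp_rw [powKernel_sub_comm s]
  have hadd : ∫⁻ y in B, ∫⁻ z in B, powKernel s (y - z) * (G y + G z) =
      (∫⁻ y in B, ∫⁻ z in B, powKernel s (y - z) * G y) +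
        ∫⁻ y in B, ∫⁻ z in B, powKernel s (y - z) * G z := by
    rw [← lintegral_add_left (Measurable.lintegral_prod_right' (f := fun p :
      EuclideanSpace ℝ (Fin n) × EuclideanSpace ℝ (Fin n) => powKernel s (p.1 - p.2) * G p.1)
      (by fun_prop))]
    refine lintegral_congr fun y => ?_
    rw [← lintegral_add_left (by fun_prop)]
    simp_rw [mul_add]
  rw [hadd, hswap, two_mul, add_mul]
  exact add_le_add hle hle

end Potential

section Riesz

variable {n : ℕ}

lemma enorm_riesz_kernel_sub_le (hn : 2 ≤ n) {β : ℝ} (hβ0 : 0 < β) (hβ1 : β < 1)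
    {y z w : EuclideanSpace ℝ (Fin n)} (hy : w ≠ y) (hz : w ≠ z) :
    ‖‖y - w‖ ^ ((1 : ℝ) - n) - ‖z - w‖ ^ ((1 : ℝ) - n)‖ₑ ≤
      ENNReal.ofReal (n * ‖y - z‖ ^ β) *
        (powKernel (n - 1 + β) (y - w) + powKernel (n - 1 + β) (z - w)) := by
  have hp : ((n - 1 : ℕ) : ℝ) = n - 1 := by
    rw [Nat.cast_sub (by omega), Nat.cast_one]
  have hn' : (2 : ℝ) ≤ n := by exact_mod_cast hn
  have key := abs_rpow_neg_sub_rpow_neg_le (p := n - 1) (by omega) hβ0 hβ1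
    (norm_pos_iff.mpr (sub_ne_zero.mpr hy.symm)) (norm_pos_iff.mpr (sub_ne_zero.mpr hz.symm))
  rw [hp, neg_sub] at key
  unfold powKernel
  rw [← ENNReal.ofReal_add (by positivity) (by positivity), ← ENNReal.ofReal_mul (by positivity),
    ← ofReal_norm, Real.norm_eq_abs]
  refine ENNReal.ofReal_le_ofReal (key.trans ?_)
  gcongr
  · linarith
  · simpa using abs_norm_sub_norm_le (y - w) (z - w)

lemma enorm_rieszPotential_sub_le (hn : 2 ≤ n) {β : ℝ} (hβ0 : 0 < β) (hβ1 : β < 1)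
    {g : EuclideanSpace ℝ (Fin n) → ℂ} (hg : Measurable g) {y z : EuclideanSpace ℝ (Fin n)}
    (hy : Integrable fun w => (‖y - w‖ ^ ((1 : ℝ) - n)) • g w)
    (hz : Integrable fun w => (‖z - w‖ ^ ((1 : ℝ) - n)) • g w) :
    ‖(∫ w, (‖y - w‖ ^ ((1 : ℝ) - n)) • g w) - ∫ w, (‖z - w‖ ^ ((1 : ℝ) - n)) • g w‖ₑ ≤
      ENNReal.ofReal (n * ‖y - z‖ ^ β) *
        (powPotential (n - 1 + β) (fun w => ‖g w‖ₑ) y +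
          powPotential (n - 1 + β) (fun w => ‖g w‖ₑ) z) := by
  have : Nontrivial (EuclideanSpace ℝ (Fin n)) :=
    Module.nontrivial_of_finrank_pos (R := ℝ) (by rw [finrank_euclideanSpace_fin]; omega)
  rw [← integral_sub hy hz]
  refine (enorm_integral_le_lintegral_enorm _).trans ?_
  unfold powPotential
  rw [← lintegral_add_left (by fun_prop), ← lintegral_const_mul _ (by fun_prop)]
  refine lintegral_mono_ae ?_
  filter_upwards [Measure.ae_ne volume y, Measure.ae_ne volume z] with w hwy hwz
  rw [← sub_smul, enorm_smul, ← add_mul, ← mul_assoc]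
  exact mul_le_mul_left (enorm_riesz_kernel_sub_le hn hβ0 hβ1 hwy hwz) _

lemma sq_div_rpow_le {α β : ℝ} {y z : EuclideanSpace ℝ (Fin n)} (hyz : y ≠ z)
    {D a b : ℝ≥0∞} (hD : D ≤ ENNReal.ofReal (n * ‖y - z‖ ^ β) * (a + b)) :
    D ^ 2 / ENNReal.ofReal (‖y - z‖ ^ ((n : ℝ) + 2 * α)) ≤
      4 * (n : ℝ≥0∞) ^ 2 * (powKernel (n + 2 * α - 2 * β) (y - z) * (a ^ 2 + b ^ 2)) := by
  have hpos : 0 < ‖y - z‖ := norm_pos_iff.mpr (sub_ne_zero.mpr hyz)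
  have hpow : powKernel (n + 2 * α - 2 * β) (y - z) =
      ENNReal.ofReal (‖y - z‖ ^ β) ^ 2 / ENNReal.ofReal (‖y - z‖ ^ ((n : ℝ) + 2 * α)) := by
    rw [powKernel, ← ENNReal.ofReal_pow (by positivity),
      ← ENNReal.ofReal_div_of_pos (by positivity), ← Real.rpow_natCast, ← Real.rpow_mul hpos.le,
      ← Real.rpow_sub hpos]
    congr 2
    push_cast
    ring
  calc _ ≤ (ENNReal.ofReal (n * ‖y - z‖ ^ β) * (a + b)) ^ 2 /
        ENNReal.ofReal (‖y - z‖ ^ ((n : ℝ) + 2 * α)) := by gcongr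
    _ ≤ (ENNReal.ofReal (n * ‖y - z‖ ^ β)) ^ 2 * (4 * (a ^ 2 + b ^ 2)) /
        ENNReal.ofReal (‖y - z‖ ^ ((n : ℝ) + 2 * α)) := by
        rw [mul_pow]
        gcongr
        exact ENNReal.add_sq_le_four_mul a b
    _ = _ := by
        rw [hpow, ENNReal.ofReal_mul (by positivity), ENNReal.ofReal_natCast, div_eq_mul_inv,
          div_eq_mul_inv]
        ring

lemma morreyGrowth_enorm_sq_morreyNorm (g : EuclideanSpace ℝ (Fin n) → ℂ) :
    MorreyGrowth n (fun w => ‖g w‖ₑ) (MorreyNorm n g ^ 2) := by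
  intro x t ht
  have h : (ENNReal.ofReal (t ^ ((2 : ℝ) - n)) * ∫⁻ y in ball x t, ‖g y‖ₑ ^ 2) ^ (1 / 2 : ℝ) ≤
      MorreyNorm n g :=
    le_iSup₂_of_le t ht (le_iSup_of_le x le_rfl)
  rw [one_div, ENNReal.rpow_inv_le_iff two_pos, ENNReal.rpow_two] at h
  calc _ = ENNReal.ofReal (t ^ ((n : ℝ) - 2)) *
        (ENNReal.ofReal (t ^ ((2 : ℝ) - n)) * ∫⁻ y in ball x t, ‖g y‖ₑ ^ 2) := by
        rw [← mul_assoc, ← ENNReal.ofReal_mul (by positivity), ← Real.rpow_add ht]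
        simp
    _ ≤ _ := mul_le_mul_right h _

lemma exists_lintegral_rieszPotential_le (hn : 2 ≤ n) {α : ℝ} (hα0 : 0 < α) (hα1 : α < 1) :
    ∃ C : ℝ≥0, ∀ g : EuclideanSpace ℝ (Fin n) → ℂ, Measurable g →
      (∀ᵐ x : EuclideanSpace ℝ (Fin n),
        Integrable (fun y => (‖x - y‖ ^ ((1 : ℝ) - (n : ℝ))) • g y)) →
      ∀ r > 0, ∀ x : EuclideanSpace ℝ (Fin n),
        ∫⁻ y in ball x r, ∫⁻ z in ball x r,
          ‖(∫ w, (‖y - w‖ ^ ((1 : ℝ) - n)) • g w) -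
            ∫ w, (‖z - w‖ ^ ((1 : ℝ) - n)) • g w‖ₑ ^ 2 /
              ENNReal.ofReal (‖y - z‖ ^ ((n : ℝ) + 2 * α)) ≤
          ENNReal.ofReal (r ^ (n - 2 * α)) * (C * MorreyNorm n g ^ 2) := by
  have hn' : (2 : ℝ) ≤ n := by exact_mod_cast hn
  have : Nontrivial (EuclideanSpace ℝ (Fin n)) :=
    Module.nontrivial_of_finrank_pos (R := ℝ) (by rw [finrank_euclideanSpace_fin]; omega)
  obtain ⟨β, hαβ, hβ1⟩ := exists_between hα1
  have hβ0 : 0 < β := hα0.trans hαβ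
  set τ : ℝ := n + 2 * α - 2 * β with hτ
  obtain ⟨C₁, hC₁⟩ := exists_volume_powKernel_ball_le (n := n) (s := τ) (by linarith)
    (by linarith)
  obtain ⟨C₂, hC₂⟩ := exists_lintegral_sq_powPotential_le hn hβ0 hβ1
  refine ⟨8 * n ^ 2 * C₁ * (ENNReal.ofReal (2 ^ (n - τ))).toNNReal * C₂,
    fun g hg hint r hr x => ?_⟩
  simp only [ENNReal.coe_mul, ENNReal.coe_toNNReal ENNReal.ofReal_ne_top]
  set G : EuclideanSpace ℝ (Fin n) → ℝ≥0∞ :=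
    fun y => powPotential (n - 1 + β) (fun w => ‖g w‖ₑ) y ^ 2 with hG
  have hGm : Measurable G := (measurable_powPotential _ (by fun_prop)).pow_const 2
  have hV : ∀ y ∈ ball x r, ∫⁻ z in ball x r, powKernel τ (y - z) ≤
      C₁ * ENNReal.ofReal ((2 * r) ^ (n - τ)) := fun y hy =>
    (lintegral_mono_set (ball_subset_ball' (by
      rw [mem_ball, dist_comm] at hy
      linarith))).trans (hC₁ y (2 * r) (by positivity))
  calc _ ≤ ∫⁻ y in ball x r, 4 * (n : ℝ≥0∞) ^ 2 *
        ∫⁻ z in ball x r, powKernel τ (y - z) * (G y + G z) := by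
        refine lintegral_mono_ae (ae_restrict_of_ae ?_)
        filter_upwards [hint] with y hy
        rw [← lintegral_const_mul _ (by fun_prop)]
        refine lintegral_mono_ae (ae_restrict_of_ae ?_)
        filter_upwards [hint, Measure.ae_ne volume y] with z hz hzy
        exact sq_div_rpow_le hzy.symm (enorm_rieszPotential_sub_le hn hβ0 hβ1 hg hy hz)
    _ = 4 * (n : ℝ≥0∞) ^ 2 * ∫⁻ y in ball x r,
        ∫⁻ z in ball x r, powKernel τ (y - z) * (G y + G z) :=
        lintegral_const_mul' _ _ (by finiteness)
    _ ≤ 4 * (n : ℝ≥0∞) ^ 2 * (2 * (C₁ * ENNReal.ofReal ((2 * r) ^ (n - τ))) *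
        (C₂ * ENNReal.ofReal (r ^ (n - 2 * β)) * MorreyNorm n g ^ 2)) := by
        refine mul_le_mul_right
          ((lintegral_lintegral_powKernel_mul_add_le hGm measurableSet_ball hV).trans ?_) _
        exact mul_le_mul_right (hC₂ _ (by fun_prop) _
          (morreyGrowth_enorm_sq_morreyNorm g) x r hr) _
    _ = _ := by
        have : ENNReal.ofReal (r ^ (n - 2 * α)) = ENNReal.ofReal (r ^ (n - τ)) *
            ENNReal.ofReal (r ^ (n - 2 * β)) := by
          rw [← ENNReal.ofReal_mul (by positivity), ← Real.rpow_add hr, hτ]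
          ring_nf
        rw [this, Real.mul_rpow (by norm_num) hr.le, ENNReal.ofReal_mul (by positivity)]
        push_cast
        ring

end Riesz

/-- `(−Δ)^{−1/2} L_{2,n−2} ⊆ Q_α` for `α ∈ (0,1)`:
if `g` has finite square Morrey norm and the Riesz potential
`f(x) = ∫ g(y)|x−y|^{1−n} dy` converges absolutely a.e., then `‖f‖_{Q_α} ≤ C ‖g‖_{L_{2,n−2}}`. -/
theorem riesz_potential_morrey_subset_Q (n : ℕ) (hn : 2 ≤ n) (α : ℝ)
    (hα0 : 0 < α) (hα1 : α < 1) :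
    ∃ C > (0 : ℝ), ∀ g : EuclideanSpace ℝ (Fin n) → ℂ,
      Measurable g → LocallyIntegrable (fun y => ‖g y‖ ^ 2) volume →
      MorreyNorm n g ≠ ⊤ →
      (∀ᵐ x : EuclideanSpace ℝ (Fin n),
        Integrable (fun y => (‖x - y‖ ^ ((1 : ℝ) - (n : ℝ))) • g y)) →
      QNorm n α (fun x => ∫ y, (‖x - y‖ ^ ((1 : ℝ) - (n : ℝ))) • g y) ≤
        ENNReal.ofReal C * MorreyNorm n g := by
  obtain ⟨K, hK⟩ := exists_lintegral_rieszPotential_le hn hα0 hα1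
  refine ⟨(K + 1 : ℝ), by positivity, fun g hg _ _ hint => ?_⟩
  refine iSup₂_le fun r hr => iSup_le fun x => ?_
  rw [one_div, ENNReal.rpow_inv_le_iff two_pos, ENNReal.rpow_two]
  calc _ ≤ ENNReal.ofReal (r ^ (2 * α - n)) *
        (ENNReal.ofReal (r ^ (n - 2 * α)) * (K * MorreyNorm n g ^ 2)) :=
        mul_le_mul_right (hK g hg hint r hr x) _
    _ = K * MorreyNorm n g ^ 2 := by
        rw [← mul_assoc, ← ENNReal.ofReal_mul (by positivity), ← Real.rpow_add hr]
        simp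
    _ ≤ (ENNReal.ofReal (K + 1) * MorreyNorm n g) ^ 2 := by
        rw [mul_pow]
        refine mul_le_mul_left ?_ _
        rw [← ENNReal.ofReal_pow (by positivity), ← ENNReal.ofReal_coe_nnreal]
        exact ENNReal.ofReal_le_ofReal (by nlinarith [K.coe_nonneg])
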